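/- Let m, n ≥ 1, let H be an invertible symmetric m×m real matrix, let A₁,…,Aₙ be m×m real matrices, let v₁,…,vₙ ∈ ℝ^m, let θ₀ ∈ ℝ^m, and on a neighborhood of 0 ∈ ℝⁿ on which H + Σ_t ε_t A_t is invertible define Θ(ε) = θ₀ − (H + Σ_t ε_t A_t)⁻¹ (Σ_t ε_t v_t). Let ℓ : ℝ^m → ℝ be twice continuously differentiable at θ₀, with gradient v′ = ∇ℓ(θ₀) and Hessian G = ∇²ℓ(θ₀). Then for all coordinates x, z ∈ {1,…,n}, the mixed second partial derivative of ε ↦ ℓ(Θ(ε)) at 0 equals (v_x)ᵀ H⁻¹ G H⁻¹ v_z + (v′)ᵀ H⁻¹ A_z H⁻¹ v_x + (v′)ᵀ H⁻¹ A_x H⁻¹ v_z. -/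

import Mathlib

open Matrix

open Filter Topology

/-- Second-order chain rule. -/
theorem fderiv_fderiv_comp_apply {E F K : Type*} [NormedAddCommGroup E] [NormedSpace ℝ E]
    [NormedAddCommGroup F] [NormedSpace ℝ F] [NormedAddCommGroup K] [NormedSpace ℝ K]
    {f : F → K} {g : E → F} {a : E} (hf : ContDiffAt ℝ 2 f (g a)) (hg : ContDiffAt ℝ 2 g a)
    (u w : E) :
    fderiv ℝ (fderiv ℝ (fun x => f (g x))) a u w
      = fderiv ℝ (fderiv ℝ f) (g a) (fderiv ℝ g a u) (fderiv ℝ g a w)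
        + fderiv ℝ f (g a) (fderiv ℝ (fderiv ℝ g) a u w) := by
  have hf' : DifferentiableAt ℝ (fderiv ℝ f) (g a) :=
    (hf.fderiv_right (m := 1) (by norm_num)).differentiableAt (by norm_num)
  have hg' : DifferentiableAt ℝ (fderiv ℝ g) a :=
    (hg.fderiv_right (m := 1) (by norm_num)).differentiableAt (by norm_num)
  have hev : fderiv ℝ (fun x => f (g x)) =ᶠ[𝓝 a]
      fun x => (fderiv ℝ f (g x)).comp (fderiv ℝ g x) := by
    filter_upwards [hg.continuousAt.eventually (hf.eventually (by simp)),
      hg.eventually (by simp)] with x hfx hgx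
    exact fderiv_comp x (hfx.differentiableAt (by norm_num)) (hgx.differentiableAt (by norm_num))
  have hgd := (hg.differentiableAt (by norm_num)).hasFDerivAt
  have h := (hf'.hasFDerivAt.comp a hgd).clm_comp hg'.hasFDerivAt
  rw [hev.fderiv_eq]
  have h2 := DFunLike.congr_fun (DFunLike.congr_fun h.fderiv u) w
  simp only [Function.comp_def] at h2
  rw [h2]
  simp [add_comm]

section AffineSystem

variable {P E : Type*} [NormedAddCommGroup P] [NormedSpace ℝ P]
  [NormedAddCommGroup E] [NormedSpace ℝ E] [CompleteSpace E]
  {L : E ≃L[ℝ] E} {A : P →L[ℝ] E →L[ℝ] E} {b : P →L[ℝ] E} {D : P → E}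

/-- The solution of a linear system depending affinely on a parameter is smooth. -/
theorem contDiffAt_of_affine_system
    (hD : ∀ᶠ ε in 𝓝 0, ((L : E →L[ℝ] E) + A ε) (D ε) = b ε) : ContDiffAt ℝ 2 D 0 := by
  have hS : ContDiff ℝ 2 fun ε => (L : E →L[ℝ] E) + A ε := contDiff_const.add A.contDiff
  have hinv : ContDiffAt ℝ 2 (fun ε => ((L : E →L[ℝ] E) + A ε).inverse) 0 := by
    refine ContDiffAt.comp (g := ContinuousLinearMap.inverse) (0 : P) ?_ hS.contDiffAt
    simpa using contDiffAt_map_inverse (𝕜 := ℝ) (n := 2) L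
  refine (hinv.clm_apply b.contDiff.contDiffAt).congr_of_eventuallyEq ?_
  have hunit : ∀ᶠ ε in 𝓝 (0 : P),
      (L : E →L[ℝ] E) + A ε ∈ Set.range ((↑) : (E ≃L[ℝ] E) → E →L[ℝ] E) := by
    refine hS.continuous.continuousAt.eventually ?_
    beta_reduce
    rw [map_zero, add_zero]
    exact ContinuousLinearEquiv.nhds L
  filter_upwards [hD, hunit] with ε h ⟨M, hM⟩
  rw [← h, ← hM]
  simp

/-- First and second derivatives at `0` of the solution of a linear system depending affinely on
a parameter, with right-hand side vanishing at `0`. -/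
theorem fderiv_of_affine_system
    (hD : ∀ᶠ ε in 𝓝 0, ((L : E →L[ℝ] E) + A ε) (D ε) = b ε) (u w : P) :
    fderiv ℝ D 0 u = L.symm (b u) ∧
    fderiv ℝ (fderiv ℝ D) 0 u w
      = -(L.symm (A u (L.symm (b w))) + L.symm (A w (L.symm (b u)))) := by
  have hC := contDiffAt_of_affine_system hD
  have hS (ε : P) : HasFDerivAt (fun ε => (L : E →L[ℝ] E) + A ε) A ε :=
    A.hasFDerivAt.const_add _
  have hD0 : D 0 = 0 := by
    have := hD.self_of_nhds
    simpa using this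
  have hev : (fun ε => ((L : E →L[ℝ] E) + A ε).comp (fderiv ℝ D ε) + A.flip (D ε))
      =ᶠ[𝓝 0] fun _ => b := by
    filter_upwards [hD.eventually_nhds, hC.eventually (by simp)] with ε h hc
    have h1 := (hS ε).clm_apply (hc.differentiableAt (by norm_num)).hasFDerivAt
    rw [← h1.fderiv, EventuallyEq.fderiv_eq (f := fun ε => b ε) h, b.fderiv]
  have hfirst (u : P) : fderiv ℝ D 0 u = L.symm (b u) := by
    have := DFunLike.congr_fun hev.self_of_nhds u
    rw [ContinuousLinearEquiv.eq_symm_apply]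
    simpa [hD0] using this
  refine ⟨hfirst u, ?_⟩
  have hD' : DifferentiableAt ℝ (fderiv ℝ D) 0 :=
    (hC.fderiv_right (m := 1) (by norm_num)).differentiableAt (by norm_num)
  have h2 := ((hS 0).clm_comp hD'.hasFDerivAt).add
    (A.flip.hasFDerivAt.comp (0 : P) (hC.differentiableAt (by norm_num)).hasFDerivAt)
  have h3 := h2.unique ((hasFDerivAt_const b (0 : P)).congr_of_eventuallyEq hev)
  have h4 := DFunLike.congr_fun (DFunLike.congr_fun h3 u) w
  simp [hfirst] at h4
  rw [← map_add, ← map_neg, ContinuousLinearEquiv.eq_symm_apply]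
  rw [add_assoc] at h4
  exact eq_neg_of_add_eq_zero_left h4

end AffineSystem

/-- Lemma 3.2 of the paper: with `Θ(ε) = θ₀ - (H + Σ_t ε_t A_t)⁻¹ (Σ_t ε_t v_t)`
(`H` invertible symmetric), and `ℓ` twice continuously differentiable at `θ₀`
with gradient `v′` and Hessian `G`, the mixed second partial of `ε ↦ ℓ(Θ(ε))`
at `0` equals `v_xᵀH⁻¹GH⁻¹v_z + (v′)ᵀH⁻¹A_zH⁻¹v_x + (v′)ᵀH⁻¹A_xH⁻¹v_z`. -/
theorem influence_second_partial (m n : ℕ) (hm : 1 ≤ m) (hn : 1 ≤ n)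
    (H : Matrix (Fin m) (Fin m) ℝ) (hH : IsUnit H.det) (hHsymm : H.IsSymm)
    (A : Fin n → Matrix (Fin m) (Fin m) ℝ) (v : Fin n → Fin m → ℝ)
    (θ₀ : Fin m → ℝ) (Θ : (Fin n → ℝ) → (Fin m → ℝ))
    (hΘ : ∀ ε, Θ ε = θ₀ - (H + ∑ t, ε t • A t)⁻¹.mulVec (∑ t, ε t • v t))
    (ℓ : (Fin m → ℝ) → ℝ) (hℓ : ContDiffAt ℝ 2 ℓ θ₀)
    (v' : Fin m → ℝ) (hv' : ∀ w, fderiv ℝ ℓ θ₀ w = v' ⬝ᵥ w)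
    (G : Matrix (Fin m) (Fin m) ℝ)
    (hG : ∀ w w' : Fin m → ℝ, iteratedFDeriv ℝ 2 ℓ θ₀ ![w, w'] = w ⬝ᵥ G.mulVec w') :
    ∀ x z : Fin n,
      iteratedFDeriv ℝ 2 (fun ε => ℓ (Θ ε)) 0 ![Pi.single x 1, Pi.single z 1]
        = v x ⬝ᵥ (H⁻¹ * G * H⁻¹).mulVec (v z)
          + v' ⬝ᵥ (H⁻¹ * A z * H⁻¹).mulVec (v x)
          + v' ⬝ᵥ (H⁻¹ * A x * H⁻¹).mulVec (v z) := by
  intro x z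
  let L : (Fin m → ℝ) ≃L[ℝ] (Fin m → ℝ) :=
    (Matrix.toLinearEquiv' H (H.invertibleOfIsUnitDet hH)).toContinuousLinearEquiv
  let T : Matrix (Fin m) (Fin m) ℝ →ₗ[ℝ] (Fin m → ℝ) →L[ℝ] (Fin m → ℝ) :=
    (LinearMap.toContinuousLinearMap : _ ≃ₗ[ℝ] _).toLinearMap ∘ₗ
      (Matrix.toLin' : _ ≃ₗ[ℝ] _).toLinearMap
  let Ac : (Fin n → ℝ) →L[ℝ] (Fin m → ℝ) →L[ℝ] (Fin m → ℝ) :=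
    LinearMap.toContinuousLinearMap (T ∘ₗ Fintype.linearCombination ℝ A)
  let b : (Fin n → ℝ) →L[ℝ] (Fin m → ℝ) :=
    LinearMap.toContinuousLinearMap (-Fintype.linearCombination ℝ v)
  have hL (w : Fin m → ℝ) : L w = H *ᵥ w := rfl
  have hLs (w : Fin m → ℝ) : L.symm w = H⁻¹ *ᵥ w := by
    rw [ContinuousLinearEquiv.symm_apply_eq, hL, mulVec_mulVec, mul_nonsing_inv _ hH, one_mulVec]
  have hA (ε : Fin n → ℝ) (w : Fin m → ℝ) : Ac ε w = (∑ t, ε t • A t) *ᵥ w := rfl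
  have hb (ε : Fin n → ℝ) : b ε = -∑ t, ε t • v t := rfl
  have hAs (t : Fin n) (w : Fin m → ℝ) : Ac (Pi.single t 1) w = A t *ᵥ w := by
    simp [hA, Pi.single_apply, ite_smul]
  have hbs (t : Fin n) : b (Pi.single t 1) = -v t := by
    simp [hb, Pi.single_apply, ite_smul]
  have hD : ∀ᶠ ε in 𝓝 0,
      ((L : (Fin m → ℝ) →L[ℝ] (Fin m → ℝ)) + Ac ε) (Θ ε - θ₀) = b ε := by
    have hdet : ContinuousAt (fun ε : Fin n → ℝ => (H + ∑ t, ε t • A t).det) 0 := by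
      apply Continuous.continuousAt
      fun_prop
    filter_upwards [hdet.eventually_ne (by simpa using hH.ne_zero)] with ε hε
    rw [_root_.add_apply, ContinuousLinearEquiv.coe_coe, hL, hA, hb, hΘ,
      ← add_mulVec, sub_sub_cancel_left, mulVec_neg, mulVec_mulVec,
      mul_nonsing_inv _ hε.isUnit, one_mulVec]
  have hΘ0 : Θ 0 = θ₀ := by simp [hΘ]
  have hfun : (fun ε => Θ ε - θ₀ + θ₀) = Θ := by simp
  have hC : ContDiffAt ℝ 2 Θ 0 := by
    rw [← hfun]
    exact (contDiffAt_of_affine_system hD).add contDiffAt_const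
  have hfd : fderiv ℝ (fun ε => Θ ε - θ₀) = fderiv ℝ Θ := by
    funext ε
    exact fderiv_sub_const θ₀
  have h1 (t : Fin n) : fderiv ℝ Θ 0 (Pi.single t 1) = -(H⁻¹ *ᵥ v t) := by
    rw [← hfd, (fderiv_of_affine_system hD (Pi.single t 1) 0).1, hbs, hLs, mulVec_neg]
  have h2 := (fderiv_of_affine_system hD (Pi.single x 1) (Pi.single z 1)).2
  rw [hfd] at h2
  have hG' (w w' : Fin m → ℝ) : fderiv ℝ (fderiv ℝ ℓ) θ₀ w w' = w ⬝ᵥ G *ᵥ w' := by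
    rw [← hG, iteratedFDeriv_two_apply]
    rfl
  have hsymm (w w' : Fin m → ℝ) : (H⁻¹ *ᵥ w) ⬝ᵥ w' = w ⬝ᵥ H⁻¹ *ᵥ w' := by
    rw [dotProduct_mulVec, ← mulVec_transpose, transpose_nonsing_inv, hHsymm.eq]
  rw [iteratedFDeriv_two_apply]
  simp only [Matrix.cons_val_zero, Matrix.cons_val_one]
  rw [fderiv_fderiv_comp_apply (by rwa [hΘ0]) hC, hΘ0, hG', hv', h1, h1, h2]
  simp only [hbs, hLs, hAs, mulVec_neg, neg_dotProduct, dotProduct_neg, neg_neg, hsymm,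
    neg_add, dotProduct_add, mulVec_mulVec, Matrix.mul_assoc]
  ring
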